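/- (Convergence of asynchronous model propagation, stated for the expectation recursion.) Let m(0) ∈ ℝ^{n²×p} be arbitrary and define m(t+1) = Ā m(t) + b̄ for all t ≥ 0; this is exactly the recursion satisfied by the expected state E[Θ̃(t)] of the asynchronous gossip model propagation algorithm. Then the sequence m(t) converges as t → ∞, and for every agent i ∈ {1,…,n} and every j ∈ N_i ∪ {i} (where N_i = {j : W_ij > 0}), row (i−1)n + j of the limit equals row j of Θ* = ᾱ (I − ᾱ(I − C) − αP)⁻¹ C Θ^loc, the unique minimizer of the model propagation objective Q_mp. -/

import Mathlib

open Matrix Finset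

/-- The standard basis vector of `ℝ^{n²}` (indexed by pairs, the pair `(i,j)` encoding
coordinate `(i−1)n + j`) with a 1 in coordinate `(i,j)`. -/
def eVec (n : ℕ) (i j : Fin n) : Fin n × Fin n → ℝ :=
  fun q => if q = (i, j) then 1 else 0

/-- The communication matrix `O(i,j) = I + e_i^j(e_j^j − e_i^j)ᵀ + e_j^i(e_i^i − e_j^i)ᵀ`. -/
def Omat (n : ℕ) (i j : Fin n) : Matrix (Fin n × Fin n) (Fin n × Fin n) ℝ :=
  1 + Matrix.vecMulVec (eVec n i j) (eVec n j j - eVec n i j)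
    + Matrix.vecMulVec (eVec n j i) (eVec n i i - eVec n j i)

/-- The `n² × n²` block-diagonal matrix with `n` diagonal blocks equal to `M`. -/
def blockDiag (n : ℕ) (M : Matrix (Fin n) (Fin n) ℝ) :
    Matrix (Fin n × Fin n) (Fin n × Fin n) ℝ :=
  Matrix.of fun q r => if q.1 = r.1 then M q.2 r.2 else 0

/-- The update matrix `U(i,j) = I + (e_i^i(e_i^i)ᵀ + e_j^j(e_j^j)ᵀ)(M_blk − I)`. -/
def Umat (n : ℕ) (M : Matrix (Fin n) (Fin n) ℝ) (i j : Fin n) :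
    Matrix (Fin n × Fin n) (Fin n × Fin n) ℝ :=
  1 + (Matrix.vecMulVec (eVec n i i) (eVec n i i)
      + Matrix.vecMulVec (eVec n j j) (eVec n j j)) * (blockDiag n M - 1)

/-- The diagonal matrix `I^E` with entry `(i,j)` equal to 1 if `(i,j) ∈ E` or `i = j`,
and 0 otherwise (edges are the pairs with `W i j > 0`). -/
noncomputable def IEmat (n : ℕ) (W : Matrix (Fin n) (Fin n) ℝ) :
    Matrix (Fin n × Fin n) (Fin n × Fin n) ℝ :=
  Matrix.diagonal fun q => if 0 < W q.1 q.2 ∨ q.1 = q.2 then 1 else 0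

open Filter Topology in
/-- A linear recursion with a positivity-preserving matrix that strictly decreases some positive
vector tends to zero. -/
theorem tendsto_zero_of_mulVec_lt {ι : Type*} [Fintype ι] (A : Matrix ι ι ℝ)
    (hA : ∀ x : ι → ℝ, (∀ q, 0 ≤ x q) → ∀ q, 0 ≤ (A *ᵥ x) q)
    (v : ι → ℝ) (hv : ∀ q, 0 < v q) (hAv : ∀ q, (A *ᵥ v) q < v q)
    (x : ℕ → ι → ℝ) (hx : ∀ t, x (t + 1) = A *ᵥ x t) (q : ι) :
    Tendsto (fun t => x t q) atTop (𝓝 0) := by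
  obtain ⟨r, hr0, hr1, hr⟩ : ∃ r : ℝ, 0 ≤ r ∧ r < 1 ∧ ∀ q, (A *ᵥ v) q ≤ r * v q := by
    have h : ∀ᶠ r : ℝ in 𝓝[<] 1, 0 ≤ r ∧ r < 1 ∧ ∀ q, (A *ᵥ v) q ≤ r * v q := by
      have h0 : ∀ᶠ r : ℝ in 𝓝[<] 1, 0 ≤ r := nhdsWithin_le_nhds (Ici_mem_nhds zero_lt_one)
      refine h0.and (eventually_mem_nhdsWithin.and (eventually_all.2 fun q => ?_))
      have hc : Tendsto (fun r : ℝ => r * v q) (𝓝[<] 1) (𝓝 (1 * v q)) :=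
        ((continuous_id.mul continuous_const).tendsto 1).mono_left nhdsWithin_le_nhds
      rw [one_mul] at hc
      exact (hc.eventually (lt_mem_nhds (hAv q))).mono fun _ h => h.le
    exact h.exists
  set K := ∑ q, |x 0 q| / v q with hK
  have hK0 : 0 ≤ K := Finset.sum_nonneg fun q _ => div_nonneg (abs_nonneg _) (hv q).le
  have key : ∀ t q, |x t q| ≤ K * r ^ t * v q := by
    intro t
    induction t with
    | zero =>
      intro q
      have h : |x 0 q| / v q ≤ K :=
        Finset.single_le_sum (f := fun q => |x 0 q| / v q)
          (fun q _ => div_nonneg (abs_nonneg _) (hv q).le) (Finset.mem_univ q)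
      rw [div_le_iff₀ (hv q)] at h
      simpa using h
    | succ t ih =>
      intro q
      have h1 := hA ((K * r ^ t) • v - x t)
        (fun q => by simpa using (abs_le.1 (ih q)).2) q
      have h2 := hA ((K * r ^ t) • v + x t)
        (fun q => by
          have := (abs_le.1 (ih q)).1
          simp only [Pi.add_apply, Pi.smul_apply, smul_eq_mul]
          linarith) q
      rw [Matrix.mulVec_sub, Matrix.mulVec_smul] at h1
      rw [Matrix.mulVec_add, Matrix.mulVec_smul] at h2
      simp only [Pi.add_apply, Pi.sub_apply, Pi.smul_apply, smul_eq_mul] at h1 h2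
      have h3 : K * r ^ t * (A *ᵥ v) q ≤ K * r ^ t * (r * v q) :=
        mul_le_mul_of_nonneg_left (hr q) (by positivity)
      rw [hx, abs_le, pow_succ]
      constructor <;> nlinarith
  refine squeeze_zero_norm (fun t => key t q) ?_
  simpa using ((tendsto_pow_atTop_nhds_zero_of_lt_one hr0 hr1).const_mul K).mul_const (v q)

/-- The action of `U(i,j) O(i,j)`: agents `i` and `j` exchange their models and then each of them
updates its own one. -/
noncomputable def gossipStep {n : ℕ} (M : Matrix (Fin n) (Fin n) ℝ) (i j : Fin n)
    (x : Fin n × Fin n → ℝ) (q : Fin n × Fin n) : ℝ :=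
  if q = (i, i) then ∑ k, M i k * (if k = j then x (j, j) else x (i, k))
  else if q = (j, j) then ∑ k, M j k * (if k = i then x (i, i) else x (j, k))
  else if q = (i, j) then x (j, j)
  else if q = (j, i) then x (i, i)
  else x q

theorem vecMulVec_mulVec_apply {ι κ : Type*} [Fintype κ] (a : ι → ℝ) (b x : κ → ℝ) (q : ι) :
    (Matrix.vecMulVec a b *ᵥ x) q = a q * (b ⬝ᵥ x) := by
  simp [Matrix.mulVec, dotProduct, Matrix.vecMulVec_apply, Finset.mul_sum, mul_assoc]

theorem eVec_dotProduct {n : ℕ} (i j : Fin n) (x : Fin n × Fin n → ℝ) :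
    eVec n i j ⬝ᵥ x = x (i, j) := by
  simp [dotProduct, eVec]

theorem Omat_mulVec {n : ℕ} (i j : Fin n) (x : Fin n × Fin n → ℝ) (q : Fin n × Fin n) :
    (Omat n i j *ᵥ x) q =
      x q + eVec n i j q * (x (j, j) - x (i, j)) + eVec n j i q * (x (i, i) - x (j, i)) := by
  simp only [Omat, Matrix.add_mulVec, Matrix.one_mulVec, Pi.add_apply, vecMulVec_mulVec_apply,
    sub_dotProduct, eVec_dotProduct]

theorem blockDiag_mulVec {n : ℕ} (M : Matrix (Fin n) (Fin n) ℝ) (x : Fin n × Fin n → ℝ)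
    (q : Fin n × Fin n) : (_root_.blockDiag n M *ᵥ x) q = ∑ k, M q.2 k * x (q.1, k) := by
  simp only [Matrix.mulVec, dotProduct, _root_.blockDiag, Matrix.of_apply, Fintype.sum_prod_type,
    ite_mul, zero_mul]
  rw [Finset.sum_comm]
  simp

theorem Umat_mulVec {n : ℕ} (M : Matrix (Fin n) (Fin n) ℝ) (i j : Fin n)
    (x : Fin n × Fin n → ℝ) (q : Fin n × Fin n) :
    (Umat n M i j *ᵥ x) q =
      x q + (eVec n i i q * (∑ k, M i k * x (i, k) - x (i, i))
        + eVec n j j q * (∑ k, M j k * x (j, k) - x (j, j))) := by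
  simp only [Umat, Matrix.add_mulVec, Matrix.one_mulVec, Pi.add_apply, vecMulVec_mulVec_apply,
    ← Matrix.mulVec_mulVec, Matrix.sub_mulVec, eVec_dotProduct, Pi.sub_apply, blockDiag_mulVec]

theorem Umat_mul_Omat_mulVec {n : ℕ} (M : Matrix (Fin n) (Fin n) ℝ) {i j : Fin n} (hij : i ≠ j)
    (x : Fin n × Fin n → ℝ) : (Umat n M i j * Omat n i j) *ᵥ x = gossipStep M i j x := by
  funext q
  have h1 : ∀ k, (Omat n i j *ᵥ x) (i, k) = if k = j then x (j, j) else x (i, k) := by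
    intro k
    rw [Omat_mulVec]
    by_cases hk : k = j <;> simp [eVec, hij, hk]
  have h2 : ∀ k, (Omat n i j *ᵥ x) (j, k) = if k = i then x (i, i) else x (j, k) := by
    intro k
    rw [Omat_mulVec]
    by_cases hk : k = i <;> simp [eVec, hij.symm, hk]
  rw [← Matrix.mulVec_mulVec, Umat_mulVec]
  simp only [h1, h2, gossipStep]
  by_cases hqi : q = (i, i)
  · subst hqi
    simp [h1, eVec, hij]
  by_cases hqj : q = (j, j)
  · subst hqj
    simp [h2, eVec, hij, hij.symm]
  rw [Omat_mulVec]
  by_cases hqij : q = (i, j)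
  · subst hqij
    simp [eVec, hij, hij.symm]
  by_cases hqji : q = (j, i)
  · subst hqji
    simp [eVec, hij, hij.symm]
  simp [eVec, hqi, hqj, hqij, hqji]

theorem gossipStep_nonneg {n : ℕ} {M : Matrix (Fin n) (Fin n) ℝ} (hM : ∀ i j, 0 ≤ M i j)
    (i j : Fin n) {x : Fin n × Fin n → ℝ} (hx : ∀ q, 0 ≤ x q) (q : Fin n × Fin n) :
    0 ≤ gossipStep M i j x q := by
  have h : ∀ a b : Fin n, 0 ≤ ∑ k, M a k * (if k = b then x (b, b) else x (a, k)) := by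
    intro a b
    refine Finset.sum_nonneg fun k _ => mul_nonneg (hM a k) ?_
    split_ifs <;> exact hx _
  unfold gossipStep
  split_ifs
  exacts [h i j, h j i, hx _, hx _, hx _]

/-- The vector with value `1` at the diagonal coordinates and `1 + ε` elsewhere. -/
noncomputable def contractionWeight {n : ℕ} (ε : ℝ) (q : Fin n × Fin n) : ℝ :=
  if q.1 = q.2 then 1 else 1 + ε

theorem sum_mul_contractionWeight_lt {n : ℕ} {M : Matrix (Fin n) (Fin n) ℝ}
    (hM : ∀ i j, 0 ≤ M i j) {ε : ℝ} (hε : 0 < ε) (hMε : ∀ i, (1 + ε) * ∑ k, M i k < 1)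
    (a b : Fin n) :
    ∑ k, M a k * (if k = b then contractionWeight ε (b, b) else contractionWeight ε (a, k)) < 1 := by
  refine lt_of_le_of_lt ?_ (hMε a)
  rw [Finset.mul_sum]
  refine Finset.sum_le_sum fun k _ => ?_
  rw [mul_comm]
  refine mul_le_mul_of_nonneg_right ?_ (hM a k)
  unfold contractionWeight
  split_ifs <;> simp_all <;> linarith

theorem gossipStep_contractionWeight_le {n : ℕ} {M : Matrix (Fin n) (Fin n) ℝ}
    (hM : ∀ i j, 0 ≤ M i j) {ε : ℝ} (hε : 0 < ε) (hMε : ∀ i, (1 + ε) * ∑ k, M i k < 1)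
    {i j : Fin n} (hij : i ≠ j) (q : Fin n × Fin n) :
    gossipStep M i j (contractionWeight ε) q ≤ contractionWeight ε q := by
  have h := sum_mul_contractionWeight_lt hM hε hMε
  have hd : ∀ a : Fin n, contractionWeight ε (a, a) = 1 := by simp [contractionWeight]
  have ho : ∀ {a b : Fin n}, a ≠ b → contractionWeight ε (a, b) = 1 + ε := by
    intro a b hab
    simp [contractionWeight, hab]
  unfold gossipStep
  split_ifs with h1 h2 h3 h4
  · rw [h1, hd i]; exact (h i j).le
  · rw [h2, hd j]; exact (h j i).le
  · rw [h3, hd, ho hij]; linarith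
  · rw [h4, hd, ho hij.symm]; linarith
  · exact le_rfl

theorem gossipStep_contractionWeight_lt {n : ℕ} {M : Matrix (Fin n) (Fin n) ℝ}
    (hM : ∀ i j, 0 ≤ M i j) {ε : ℝ} (hε : 0 < ε) (hMε : ∀ i, (1 + ε) * ∑ k, M i k < 1)
    {i j : Fin n} (hij : i ≠ j) {q : Fin n × Fin n} (hq : q = (i, i) ∨ q = (i, j)) :
    gossipStep M i j (contractionWeight ε) q < contractionWeight ε q := by
  have h := sum_mul_contractionWeight_lt hM hε hMε i j
  rcases hq with rfl | rfl
  · simpa [gossipStep, contractionWeight] using h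
  · simpa [gossipStep, contractionWeight, hij, hij.symm] using hε

/-- The linear part of the expectation recursion is an average of gossip steps. -/
theorem expectation_mulVec {n : ℕ} {W : Matrix (Fin n) (Fin n) ℝ}
    (M : Matrix (Fin n) (Fin n) ℝ) {π : Fin n → Fin n → ℝ} (hπ : ∀ i, π i i = 0)
    (x : Fin n × Fin n → ℝ) (q : Fin n × Fin n) :
    (((1 / (n : ℝ)) • (IEmat n W *
      ∑ i, ∑ j, if i = j then 0 else π i j • (Umat n M i j * Omat n i j))) *ᵥ x) q =
    (if 0 < W q.1 q.2 ∨ q.1 = q.2 then 1 else 0) *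
      ((1 / (n : ℝ)) * ∑ i, ∑ j, π i j * gossipStep M i j x q) := by
  rw [Matrix.smul_mulVec, ← Matrix.mulVec_mulVec, Pi.smul_apply, IEmat, Matrix.mulVec_diagonal,
    Matrix.sum_mulVec, Finset.sum_apply, smul_eq_mul, mul_left_comm]
  congr 2
  refine Finset.sum_congr rfl fun i _ => ?_
  rw [Matrix.sum_mulVec, Finset.sum_apply]
  refine Finset.sum_congr rfl fun j _ => ?_
  split_ifs with hij
  · simp [← hij, hπ]
  · rw [Matrix.smul_mulVec, Umat_mul_Omat_mulVec M hij, Pi.smul_apply, smul_eq_mul]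

theorem sum_sum_eq_two_mul_sum_lt {n : ℕ} (f : Fin n → Fin n → ℝ) (hs : ∀ i j, f i j = f j i)
    (hd : ∀ i, f i i = 0) :
    ∑ i, ∑ j, f i j = 2 * ∑ i, ∑ j, if i < j then f i j else 0 := by
  have h : ∑ i, ∑ j, f i j =
      ∑ i, ∑ j, ((if i < j then f i j else 0) + if j < i then f j i else 0) := by
    refine Finset.sum_congr rfl fun i _ => Finset.sum_congr rfl fun j _ => ?_
    rcases lt_trichotomy i j with h | h | h
    · simp [h, h.not_gt]
    · subst h; simp [hd]
    · simp [h, h.not_gt, hs i j]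
  rw [h]
  simp only [Finset.sum_add_distrib]
  rw [Finset.sum_comm (f := fun i j => if j < i then f j i else 0), two_mul]

/-- The scalar model propagation objective. -/
noncomputable def propObjective {n : ℕ} (W : Matrix (Fin n) (Fin n) ℝ) (d ℓ x : Fin n → ℝ) : ℝ :=
  (1 / 2) * ((∑ i, ∑ j, if i < j then W i j * (x i - x j) ^ 2 else 0)
    + ∑ i, d i * (x i - ℓ i) ^ 2)

/-- Strong convexity of the objective at a stationary point `y`. -/
theorem propObjective_add_le {n : ℕ} {W : Matrix (Fin n) (Fin n) ℝ} (hW : ∀ i j, W i j = W j i)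
    (hW0 : ∀ i j, 0 ≤ W i j) (d ℓ x y : Fin n → ℝ)
    (hy : ∀ i, ∑ j, W i j * (y i - y j) + d i * (y i - ℓ i) = 0) :
    propObjective W d ℓ y + (1 / 2) * ∑ i, d i * (x i - y i) ^ 2 ≤ propObjective W d ℓ x := by
  have hsum : ∀ z : Fin n → ℝ, (∑ i, ∑ j, if i < j then W i j * (z i - z j) ^ 2 else 0)
      = (1 / 2) * ∑ i, ∑ j, W i j * (z i - z j) ^ 2 := by
    intro z
    rw [sum_sum_eq_two_mul_sum_lt (fun i j => W i j * (z i - z j) ^ 2)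
      (fun i j => by rw [hW i j]; ring) (fun i => by simp)]
    ring
  have hcross : ∑ i, ∑ j, W i j * (y i - y j) * ((x i - y i) - (x j - y j))
      = 2 * ∑ i, (∑ j, W i j * (y i - y j)) * (x i - y i) := by
    have h1 : ∑ i, ∑ j, W i j * (y i - y j) * (x j - y j)
        = - ∑ i, ∑ j, W i j * (y i - y j) * (x i - y i) := by
      rw [Finset.sum_comm, ← Finset.sum_neg_distrib]
      refine Finset.sum_congr rfl fun i _ => ?_
      rw [← Finset.sum_neg_distrib]
      refine Finset.sum_congr rfl fun j _ => ?_
      rw [hW j i]; ring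
    simp only [mul_sub _ (x _ - y _) (x _ - y _), Finset.sum_sub_distrib, h1, Finset.sum_mul]
    ring
  have hstat : ∑ i, (∑ j, W i j * (y i - y j)) * (x i - y i)
      + ∑ i, d i * (y i - ℓ i) * (x i - y i) = 0 := by
    rw [← Finset.sum_add_distrib]
    refine Finset.sum_eq_zero fun i _ => ?_
    rw [← add_mul, hy i, zero_mul]
  have hpos : 0 ≤ ∑ i, ∑ j, W i j * ((x i - y i) - (x j - y j)) ^ 2 :=
    Finset.sum_nonneg fun i _ => Finset.sum_nonneg fun j _ => mul_nonneg (hW0 i j) (sq_nonneg _)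
  have hexp : ∑ i, ∑ j, W i j * (x i - x j) ^ 2 = ∑ i, ∑ j, W i j * (y i - y j) ^ 2
      + 2 * ∑ i, ∑ j, W i j * (y i - y j) * ((x i - y i) - (x j - y j))
      + ∑ i, ∑ j, W i j * ((x i - y i) - (x j - y j)) ^ 2 := by
    simp only [Finset.mul_sum, ← Finset.sum_add_distrib]
    refine Finset.sum_congr rfl fun i _ => Finset.sum_congr rfl fun j _ => ?_
    ring
  have hexp' : ∑ i, d i * (x i - ℓ i) ^ 2 = ∑ i, d i * (y i - ℓ i) ^ 2
      + 2 * ∑ i, d i * (y i - ℓ i) * (x i - y i) + ∑ i, d i * (x i - y i) ^ 2 := by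
    simp only [Finset.mul_sum, ← Finset.sum_add_distrib]
    refine Finset.sum_congr rfl fun i _ => ?_
    ring
  simp only [propObjective, hsum]
  linarith

theorem propObjective_sum_lt {n p : ℕ} {W : Matrix (Fin n) (Fin n) ℝ} (hW : ∀ i j, W i j = W j i)
    (hW0 : ∀ i j, 0 ≤ W i j) {d : Fin n → ℝ} (hd : ∀ i, 0 < d i) (L X Y : Matrix (Fin n) (Fin p) ℝ)
    (hY : ∀ i k, ∑ j, W i j * (Y i k - Y j k) + d i * (Y i k - L i k) = 0) (hne : X ≠ Y) :
    ∑ k, propObjective W d (fun i => L i k) (fun i => Y i k)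
      < ∑ k, propObjective W d (fun i => L i k) (fun i => X i k) := by
  have hle := fun k => propObjective_add_le hW hW0 d (fun i => L i k) (fun i => X i k)
    (fun i => Y i k) fun i => hY i k
  have hnn : ∀ k i, 0 ≤ d i * (X i k - Y i k) ^ 2 := fun k i =>
    mul_nonneg (hd i).le (sq_nonneg _)
  obtain ⟨i, k, hik⟩ : ∃ i k, X i k ≠ Y i k := by
    by_contra! h
    exact hne (Matrix.ext h)
  refine Finset.sum_lt_sum (fun k _ => ?_) ⟨k, Finset.mem_univ k, ?_⟩
  · have := Finset.sum_nonneg fun i (_ : i ∈ Finset.univ) => hnn k i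
    linarith [hle k]
  · have h1 : 0 < ∑ i, d i * (X i k - Y i k) ^ 2 :=
      Finset.sum_pos' (fun i _ => hnn k i) ⟨i, Finset.mem_univ i,
        mul_pos (hd i) (by have := sub_ne_zero.2 hik; positivity)⟩
    linarith [hle k]

theorem degree_pos {n : ℕ} (hn : 2 ≤ n) {W : Matrix (Fin n) (Fin n) ℝ}
    (hWsymm : ∀ i j, W i j = W j i) (hWnn : ∀ i j, 0 ≤ W i j)
    (hconn : (SimpleGraph.fromRel (fun i j => 0 < W i j)).Connected) (i : Fin n) :
    0 < ∑ j, W i j := by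
  have : Nontrivial (Fin n) := Fin.nontrivial_iff_two_le.2 hn
  obtain ⟨j, hj⟩ := hconn.preconnected.exists_adj_of_nontrivial i
  have hij : 0 < W i j := by
    rcases (SimpleGraph.fromRel_adj _ _ _).1 hj with ⟨-, h | h⟩
    · exact h
    · rwa [hWsymm]
  exact Finset.sum_pos' (fun j _ => hWnn i j) ⟨j, Finset.mem_univ j, hij⟩

open Filter Topology in
theorem exists_pos_mul_lt_one {ι : Type*} [Finite ι] (s : ι → ℝ) (hs : ∀ i, s i < 1) :
    ∃ ε : ℝ, 0 < ε ∧ ∀ i, (1 + ε) * s i < 1 := by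
  have h : ∀ᶠ ε : ℝ in 𝓝[>] 0, 0 < ε ∧ ∀ i, (1 + ε) * s i < 1 := by
    refine eventually_mem_nhdsWithin.and (eventually_all.2 fun i => ?_)
    have hc : Tendsto (fun ε : ℝ => (1 + ε) * s i) (𝓝[>] 0) (𝓝 ((1 + 0) * s i)) :=
      (((continuous_const.add continuous_id).mul continuous_const).tendsto 0).mono_left
        nhdsWithin_le_nhds
    exact hc.eventually (gt_mem_nhds (by simpa using hs i))
  exact h.exists

/-- Local copies of a vector: coordinate `(i,j)` holds `θ j` when `j` is `i` or one of its
neighbours, and `0` otherwise. -/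
noncomputable def localCopies {n : ℕ} (W : Matrix (Fin n) (Fin n) ℝ) (θ : Fin n → ℝ)
    (q : Fin n × Fin n) : ℝ :=
  if 0 < W q.1 q.2 ∨ q.1 = q.2 then θ q.2 else 0

theorem gossipStep_localCopies {n : ℕ} {W M : Matrix (Fin n) (Fin n) ℝ}
    (hW : ∀ i j, W i j = W j i) (hM : ∀ i j, ¬ 0 < W i j → M i j = 0) {θ g : Fin n → ℝ}
    (hθ : ∀ i, ∑ k, M i k * θ k + g i = θ i) {i j : Fin n} (hij : i ≠ j) (hWij : 0 < W i j)
    (q : Fin n × Fin n) :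
    gossipStep M i j (localCopies W θ) q + (eVec n i i q + eVec n j j q) * g q.2
      = localCopies W θ q := by
  have hd : ∀ a, localCopies W θ (a, a) = θ a := by simp [localCopies]
  have hsum : ∀ a b, ∑ k, M a k * (if k = b then localCopies W θ (b, b)
      else localCopies W θ (a, k)) = ∑ k, M a k * θ k := by
    intro a b
    refine Finset.sum_congr rfl fun k _ => ?_
    by_cases hk : 0 < W a k
    · split_ifs with h
      · rw [hd, h]
      · simp [localCopies, hk]
    · simp [hM a k hk]
  unfold gossipStep
  split_ifs with h1 h2 h3 h4
  · subst h1
    rw [hsum, hd]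
    simpa [eVec, hij] using hθ i
  · subst h2
    rw [hsum, hd]
    simpa [eVec, hij.symm] using hθ j
  · subst h3
    simp [eVec, hij, hij.symm, localCopies, hWij]
  · subst h4
    simp [eVec, hij, hij.symm, localCopies, hW j i, hWij]
  · simp [eVec, h1, h2]

theorem sum_prob_eq {n : ℕ} {π : Fin n → Fin n → ℝ} (hπsum : ∀ i, ∑ j, π i j = 1) :
    ∑ i, ∑ j, π i j = n := by
  simp [hπsum]

/-- The averaged gossip matrix strictly decreases the contraction weight. -/
theorem expectation_contractionWeight_lt {n : ℕ} (hn : 0 < n) {W M : Matrix (Fin n) (Fin n) ℝ}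
    (hWdiag : ∀ i, W i i = 0) (hM : ∀ i j, 0 ≤ M i j) {ε : ℝ} (hε : 0 < ε)
    (hMε : ∀ i, (1 + ε) * ∑ k, M i k < 1) {π : Fin n → Fin n → ℝ} (hπnn : ∀ i j, 0 ≤ π i j)
    (hπsum : ∀ i, ∑ j, π i j = 1) (hπpos : ∀ i j, 0 < π i j ↔ 0 < W i j) (q : Fin n × Fin n) :
    (if 0 < W q.1 q.2 ∨ q.1 = q.2 then 1 else 0) *
      ((1 / (n : ℝ)) * ∑ i, ∑ j, π i j * gossipStep M i j (contractionWeight ε) q)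
      < contractionWeight ε q := by
  have hn' : (0 : ℝ) < n := by exact_mod_cast hn
  have hv : 0 < contractionWeight ε q := by
    unfold contractionWeight
    split_ifs <;> linarith
  have hne : ∀ {i j}, 0 < π i j → i ≠ j := by
    rintro i j h rfl
    exact absurd ((hπpos i i).1 h) (by simp [hWdiag])
  have hle : ∀ i j, π i j * gossipStep M i j (contractionWeight ε) q
      ≤ π i j * contractionWeight ε q := by
    intro i j
    rcases (hπnn i j).eq_or_lt with h | h
    · simp [← h]
    · exact mul_le_mul_of_nonneg_left (gossipStep_contractionWeight_le hM hε hMε (hne h) q) h.le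
  split_ifs with hq
  · obtain ⟨i, j, hij, hqij⟩ : ∃ i j, 0 < π i j ∧ (q = (i, i) ∨ q = (i, j)) := by
      rcases hq with hq | hq
      · exact ⟨q.1, q.2, (hπpos _ _).2 hq, Or.inr rfl⟩
      · obtain ⟨j, -, hj⟩ : ∃ j ∈ Finset.univ, (0 : ℝ) < π q.1 j :=
          Finset.exists_lt_of_sum_lt (by simp [hπsum])
        exact ⟨q.1, j, hj, Or.inl (Prod.ext rfl hq.symm)⟩
    have hlt : ∑ i, ∑ j, π i j * gossipStep M i j (contractionWeight ε) q
        < ∑ i, ∑ j, π i j * contractionWeight ε q :=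
      Finset.sum_lt_sum (fun i _ => Finset.sum_le_sum fun j _ => hle i j)
        ⟨i, Finset.mem_univ i, Finset.sum_lt_sum (fun j _ => hle i j) ⟨j, Finset.mem_univ j,
          mul_lt_mul_of_pos_left
            (gossipStep_contractionWeight_lt hM hε hMε (hne hij) hqij) hij⟩⟩
    simp only [← Finset.sum_mul, sum_prob_eq hπsum] at hlt
    rw [one_mul, one_div, inv_mul_lt_iff₀ hn']
    exact hlt
  · simpa using hv

/-- The local copies of a fixed point of the synchronous update are a fixed point of the
expectation recursion. -/
theorem expectation_localCopies {n : ℕ} (hn : 0 < n) {W M : Matrix (Fin n) (Fin n) ℝ}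
    (hWsymm : ∀ i j, W i j = W j i) (hWdiag : ∀ i, W i i = 0)
    (hM : ∀ i j, ¬ 0 < W i j → M i j = 0) {π : Fin n → Fin n → ℝ} (hπnn : ∀ i j, 0 ≤ π i j)
    (hπsum : ∀ i, ∑ j, π i j = 1) (hπpos : ∀ i j, 0 < π i j ↔ 0 < W i j) {θ g : Fin n → ℝ}
    (hθ : ∀ i, ∑ k, M i k * θ k + g i = θ i) (q : Fin n × Fin n) :
    (if 0 < W q.1 q.2 ∨ q.1 = q.2 then 1 else 0) *
      ((1 / (n : ℝ)) * ∑ i, ∑ j, π i j * gossipStep M i j (localCopies W θ) q)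
      + (1 / (n : ℝ)) * ∑ i, ∑ j, π i j * ((eVec n i i q + eVec n j j q) * g q.2)
      = localCopies W θ q := by
  have hn' : (n : ℝ) ≠ 0 := by exact_mod_cast hn.ne'
  by_cases hq : 0 < W q.1 q.2 ∨ q.1 = q.2
  · rw [if_pos hq, one_mul, ← mul_add]
    simp only [← Finset.sum_add_distrib, ← mul_add]
    have h : ∀ i j, π i j * (gossipStep M i j (localCopies W θ) q
        + (eVec n i i q + eVec n j j q) * g q.2) = π i j * localCopies W θ q := by
      intro i j
      rcases (hπnn i j).eq_or_lt with h | h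
      · simp [← h]
      · have hW := (hπpos i j).1 h
        have hij : i ≠ j := by
          rintro rfl
          simp [hWdiag] at hW
        rw [gossipStep_localCopies hWsymm hM hθ hij hW]
    simp only [h, ← Finset.sum_mul, sum_prob_eq hπsum]
    field_simp
  · have he : ∀ i, eVec n i i q = 0 := by
      intro i
      refine if_neg ?_
      rintro rfl
      simp at hq
    simp [hq, he, localCopies]

theorem blockDiag_diagonal {n : ℕ} (d : Fin n → ℝ) :
    _root_.blockDiag n (Matrix.diagonal d) = Matrix.diagonal fun q => d q.2 := by
  ext ⟨a₁, a₂⟩ ⟨b₁, b₂⟩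
  by_cases h₁ : a₁ = b₁ <;> by_cases h₂ : a₂ = b₂ <;>
    simp [_root_.blockDiag, Matrix.diagonal_apply, h₁, h₂]

theorem inv_diagonal_of_ne_zero {ι : Type*} [Fintype ι] [DecidableEq ι] {d : ι → ℝ}
    (hd : ∀ i, d i ≠ 0) : (Matrix.diagonal d)⁻¹ = Matrix.diagonal fun i => (d i)⁻¹ := by
  refine Matrix.inv_eq_right_inv ?_
  rw [Matrix.diagonal_mul_diagonal, ← Matrix.diagonal_one]
  simp [hd]

theorem vecMulVec_eVec_mul {n p : ℕ} (i : Fin n) (X : Matrix (Fin n × Fin n) (Fin p) ℝ)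
    (q : Fin n × Fin n) (k : Fin p) :
    (Matrix.vecMulVec (eVec n i i) (eVec n i i) * X) q k = eVec n i i q * X q k := by
  rw [Matrix.mul_apply]
  simp only [Matrix.vecMulVec_apply, eVec]
  by_cases hq : q = (i, i) <;> simp [hq]

open Filter Topology in
/-- For any initial value `m(0)`, the expectation recursion
`m(t+1) = Ā m(t) + b̄` of the asynchronous gossip model propagation algorithm converges, and
for every agent `i` and every `j ∈ N_i ∪ {i}`, row `(i,j)` of the limit equals row `j` of
`Θ* = ᾱ(I − ᾱ(I−C) − αP)⁻¹ C Θ^loc`, the unique minimizer of `Q_mp`. -/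
theorem async_model_propagation_converges
    (n p : ℕ) (hn : 2 ≤ n) (hp : 1 ≤ p)
    (W : Matrix (Fin n) (Fin n) ℝ)
    (hWsymm : ∀ i j, W i j = W j i)
    (hWnn : ∀ i j, 0 ≤ W i j)
    (hWdiag : ∀ i, W i i = 0)
    (hconn : (SimpleGraph.fromRel (fun i j => 0 < W i j)).Connected)
    (D : Matrix (Fin n) (Fin n) ℝ)
    (hD : D = Matrix.diagonal (fun i => ∑ j, W i j))
    (P : Matrix (Fin n) (Fin n) ℝ) (hP : P = D⁻¹ * W)
    (c : Fin n → ℝ) (hc : ∀ i, 0 < c i ∧ c i ≤ 1)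
    (C : Matrix (Fin n) (Fin n) ℝ) (hC : C = Matrix.diagonal c)
    (α : ℝ) (hα : 0 < α ∧ α < 1)
    (Θloc : Matrix (Fin n) (Fin p) ℝ)
    (Q : Matrix (Fin n) (Fin p) ℝ → ℝ)
    (hQ : ∀ Θ, Q Θ = (1/2) *
      ((∑ i, ∑ j, if i < j then W i j * (∑ k, (Θ i k - Θ j k)^2) else 0)
        + ((1-α)/α) * ∑ i, D i i * c i * (∑ k, (Θ i k - Θloc i k)^2)))
    (M : Matrix (Fin n) (Fin n) ℝ)
    (hM : M = (α • (1 : Matrix (Fin n) (Fin n) ℝ) + (1-α) • C)⁻¹ * (α • P))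
    (π : Fin n → Fin n → ℝ)
    (hπnn : ∀ i j, 0 ≤ π i j)
    (hπsum : ∀ i, ∑ j, π i j = 1)
    (hπpos : ∀ i j, 0 < π i j ↔ 0 < W i j)
    (Abar : Matrix (Fin n × Fin n) (Fin n × Fin n) ℝ)
    (hAbar : Abar = (1/(n:ℝ)) •
      (IEmat n W * ∑ i, ∑ j, if i = j then 0 else π i j • (Umat n M i j * Omat n i j)))
    -- vertical stacking of n copies of Θ^loc
    (Θblk : Matrix (Fin n × Fin n) (Fin p) ℝ) (hΘblk : Θblk = Matrix.of fun q => Θloc q.2)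
    -- u(i,j) = (e_i^i(e_i^i)ᵀ + e_j^j(e_j^j)ᵀ) A_blk⁻¹ ᾱ C_blk Θ̃^loc
    (u : Fin n → Fin n → Matrix (Fin n × Fin n) (Fin p) ℝ)
    (hu : ∀ i j, u i j =
      (Matrix.vecMulVec (eVec n i i) (eVec n i i) + Matrix.vecMulVec (eVec n j j) (eVec n j j)) *
        ((blockDiag n (α • (1 : Matrix (Fin n) (Fin n) ℝ) + (1-α) • C))⁻¹ *
          ((1-α) • (blockDiag n C * Θblk))))
    (bbar : Matrix (Fin n × Fin n) (Fin p) ℝ)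
    (hbbar : bbar = (1/(n:ℝ)) • ∑ i, ∑ j, if i = j then 0 else π i j • u i j)
    (Θstar : Matrix (Fin n) (Fin p) ℝ)
    (hΘstar : Θstar =
      (1-α) • ((1 - (1-α) • ((1 : Matrix (Fin n) (Fin n) ℝ) - C) - α • P)⁻¹ * C * Θloc))
    (m : ℕ → Matrix (Fin n × Fin n) (Fin p) ℝ)
    (hm : ∀ t, m (t+1) = Abar * m t + bbar) :
    ∃ Lm : Matrix (Fin n × Fin n) (Fin p) ℝ,
      Tendsto m atTop (𝓝 Lm) ∧
      (∀ i j : Fin n, (0 < W i j ∨ j = i) → Lm (i, j) = Θstar j) ∧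
      (∀ Θ, Θ ≠ Θstar → Q Θstar < Q Θ) := by
  obtain ⟨hα0, hα1⟩ := hα
  have hn0 : 0 < n := by omega
  have hdeg := degree_pos hn hWsymm hWnn hconn
  have hP' : ∀ i j, P i j = (∑ k, W i k)⁻¹ * W i j := by
    intro i j
    rw [hP, hD, inv_diagonal_of_ne_zero fun i => (hdeg i).ne', Matrix.diagonal_mul]
  have hPsum : ∀ i, ∑ j, P i j = 1 := by
    intro i
    simp only [hP', ← Finset.mul_sum]
    exact inv_mul_cancel₀ (hdeg i).ne'
  have hPnn : ∀ i j, 0 ≤ P i j := fun i j => by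
    rw [hP']
    exact mul_nonneg (inv_nonneg.2 (hdeg i).le) (hWnn i j)
  have hPdiag : ∀ i, P i i = 0 := fun i => by rw [hP', hWdiag, mul_zero]
  have hac : ∀ i, 0 < (1 - α) * c i := fun i => mul_pos (by linarith) (hc i).1
  set a : Fin n → ℝ := fun i => α + (1 - α) * c i with ha
  have hapos : ∀ i, 0 < a i := fun i => add_pos hα0 (hac i)
  have hA : α • (1 : Matrix (Fin n) (Fin n) ℝ) + (1 - α) • C = Matrix.diagonal a := by
    rw [hC, ← Matrix.diagonal_one, ← Matrix.diagonal_smul, ← Matrix.diagonal_smul,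
      Matrix.diagonal_add]
    congr 1
    funext i
    simp [ha]
  have hM' : ∀ i j, M i j = (a i)⁻¹ * (α * P i j) := by
    intro i j
    rw [hM, hA, inv_diagonal_of_ne_zero fun i => (hapos i).ne', Matrix.diagonal_mul,
      Matrix.smul_apply, smul_eq_mul]
  have hMnn : ∀ i j, 0 ≤ M i j := fun i j => by
    rw [hM']
    exact mul_nonneg (inv_nonneg.2 (hapos i).le) (mul_nonneg hα0.le (hPnn i j))
  have hMsum : ∀ i, ∑ j, M i j < 1 := by
    intro i
    simp only [hM', ← Finset.mul_sum, hPsum, mul_one]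
    rw [inv_mul_lt_iff₀ (hapos i)]
    simp only [ha]
    linarith [hac i]
  have hM0 : ∀ i j, ¬ 0 < W i j → M i j = 0 := fun i j h => by
    rw [hM', hP', le_antisymm (not_lt.1 h) (hWnn i j)]
    simp
  -- the linear system characterizing the optimal models
  have hN : (1 - (1 - α) • ((1 : Matrix (Fin n) (Fin n) ℝ) - C) - α • P)
      = Matrix.diagonal a - α • P := by
    rw [← hA, smul_sub, sub_smul, one_smul]
    abel
  have hdet : (Matrix.diagonal a - α • P).det ≠ 0 := by
    refine det_ne_zero_of_sum_row_lt_diag fun i => ?_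
    have h1 : ∀ j ∈ Finset.univ.erase i, ‖(Matrix.diagonal a - α • P) i j‖ = α * P i j := by
      intro j hj
      rw [Matrix.sub_apply, Matrix.diagonal_apply_ne' _ (Finset.ne_of_mem_erase hj), zero_sub,
        norm_neg, Matrix.smul_apply, smul_eq_mul, Real.norm_of_nonneg]
      exact mul_nonneg hα0.le (hPnn i j)
    rw [Finset.sum_congr rfl h1, ← Finset.mul_sum, Finset.sum_erase _ (hPdiag i), hPsum,
      Matrix.sub_apply, Matrix.diagonal_apply_eq, Matrix.smul_apply, hPdiag, smul_zero, sub_zero,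
      Real.norm_of_nonneg (hapos i).le, mul_one]
    simp only [ha]
    linarith [hac i]
  have hsys : (Matrix.diagonal a - α • P) * Θstar = (1 - α) • (C * Θloc) := by
    rw [hΘstar, hN, Matrix.mul_smul, Matrix.mul_assoc,
      Matrix.mul_nonsing_inv_cancel_left _ _ (isUnit_iff_ne_zero.2 hdet)]
  have hsys' : ∀ i k, a i * Θstar i k - α * ∑ j, P i j * Θstar j k
      = (1 - α) * (c i * Θloc i k) := by
    intro i k
    have h := congrFun (congrFun hsys i) k
    rw [Matrix.sub_mul, Matrix.sub_apply, Matrix.diagonal_mul, Matrix.smul_mul, Matrix.smul_apply,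
      Matrix.smul_apply, hC, Matrix.diagonal_mul, Matrix.mul_apply, smul_eq_mul, smul_eq_mul] at h
    exact h
  set g : Fin p → Fin n → ℝ := fun k i => (a i)⁻¹ * ((1 - α) * (c i * Θloc i k)) with hg
  have hfix : ∀ k i, ∑ j, M i j * Θstar j k + g k i = Θstar i k := by
    intro k i
    have h : ∑ j, M i j * Θstar j k = (a i)⁻¹ * (α * ∑ j, P i j * Θstar j k) := by
      simp only [hM', Finset.mul_sum, mul_assoc]
    rw [h]
    simp only [hg]
    rw [← mul_add, ← hsys', add_sub_cancel, inv_mul_cancel_left₀ (hapos i).ne']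
  have hπdiag : ∀ i, π i i = 0 := fun i =>
    le_antisymm (not_lt.1 fun h => by simpa [hWdiag] using (hπpos i i).1 h) (hπnn i i)
  have hu' : ∀ i j q k, u i j q k = (eVec n i i q + eVec n j j q) * g k q.2 := by
    intro i j q k
    rw [hu, hA, blockDiag_diagonal, inv_diagonal_of_ne_zero (d := fun q : Fin n × Fin n => a q.2)
        fun q => (hapos q.2).ne', hC,
      blockDiag_diagonal, Matrix.add_mul, Matrix.add_apply, vecMulVec_eVec_mul,
      vecMulVec_eVec_mul, Matrix.diagonal_mul, Matrix.smul_apply, Matrix.diagonal_mul, hΘblk,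
      Matrix.of_apply, smul_eq_mul, add_mul]
  have hb : ∀ q k, bbar q k
      = (1 / (n : ℝ)) * ∑ i, ∑ j, π i j * ((eVec n i i q + eVec n j j q) * g k q.2) := by
    intro q k
    rw [hbbar, Matrix.smul_apply, smul_eq_mul, Matrix.sum_apply]
    congr 1
    refine Finset.sum_congr rfl fun i _ => ?_
    rw [Matrix.sum_apply]
    refine Finset.sum_congr rfl fun j _ => ?_
    split_ifs with h
    · simp [← h, hπdiag]
    · rw [Matrix.smul_apply, hu', smul_eq_mul]
  have hAb : ∀ x q, (Abar *ᵥ x) q = (if 0 < W q.1 q.2 ∨ q.1 = q.2 then 1 else 0) *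
      ((1 / (n : ℝ)) * ∑ i, ∑ j, π i j * gossipStep M i j x q) := by
    intro x q
    rw [hAbar]
    exact expectation_mulVec M hπdiag x q
  obtain ⟨ε, hε, hMε⟩ := exists_pos_mul_lt_one (fun i => ∑ j, M i j) hMsum
  refine ⟨Matrix.of fun q k => localCopies W (fun i => Θstar i k) q, ?_, ?_, ?_⟩
  · refine tendsto_pi_nhds.2 fun q => tendsto_pi_nhds.2 fun k => ?_
    have h := tendsto_zero_of_mulVec_lt Abar (fun x hx q => ?_) (contractionWeight ε)
      (fun q => ?_) (fun q => ?_)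
      (fun t q => m t q k - localCopies W (fun i => Θstar i k) q) (fun t => ?_) q
    · simpa using h.add_const (localCopies W (fun i => Θstar i k) q)
    · rw [hAb]
      refine mul_nonneg (by split_ifs <;> simp) (mul_nonneg (by positivity) ?_)
      exact Finset.sum_nonneg fun i _ => Finset.sum_nonneg fun j _ =>
        mul_nonneg (hπnn i j) (gossipStep_nonneg hMnn i j hx q)
    · unfold contractionWeight
      split_ifs <;> linarith
    · rw [hAb]
      exact expectation_contractionWeight_lt hn0 hWdiag hMnn hε hMε hπnn hπsum hπpos q
    · funext q
      have h1 : m (t + 1) q k = (Abar *ᵥ fun r => m t r k) q + bbar q k := by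
        rw [hm, Matrix.add_apply, Matrix.mul_apply]
        rfl
      have h2 := expectation_localCopies hn0 hWsymm hWdiag hM0 hπnn hπsum hπpos (hfix k) q
      rw [← hAb, ← hb] at h2
      have h3 : (fun q => m t q k - localCopies W (fun i => Θstar i k) q)
          = (fun q => m t q k) - localCopies W (fun i => Θstar i k) := rfl
      rw [h3, Matrix.mulVec_sub, Pi.sub_apply, h1]
      linarith
  · intro i j hij
    funext k
    have h : 0 < W i j ∨ i = j := hij.imp id Eq.symm
    simp [localCopies, h]
  · intro Θ hΘ
    set d : Fin n → ℝ := fun i => (1 - α) / α * ((∑ j, W i j) * c i) with hd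
    have hQ' : ∀ X, Q X = ∑ k, propObjective W d (fun i => Θloc i k) (fun i => X i k) := by
      intro X
      simp only [hQ, propObjective, ← Finset.mul_sum, Finset.sum_add_distrib]
      congr 2
      · symm
        rw [Finset.sum_comm]
        refine Finset.sum_congr rfl fun i _ => ?_
        rw [Finset.sum_comm]
        refine Finset.sum_congr rfl fun j _ => ?_
        split_ifs
        · rw [Finset.mul_sum]
        · simp
      · symm
        rw [Finset.sum_comm, Finset.mul_sum]
        refine Finset.sum_congr rfl fun i _ => ?_
        rw [← Finset.mul_sum, hD, Matrix.diagonal_apply_eq, ← mul_assoc]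
    rw [hQ', hQ']
    refine propObjective_sum_lt hWsymm hWnn (fun i => ?_) Θloc Θ Θstar (fun i k => ?_) hΘ
    · exact mul_pos (div_pos (by linarith) hα0) (mul_pos (hdeg i) (hc i).1)
    · have h := hsys' i k
      have h1 : ∑ j, P i j * Θstar j k = (∑ j, W i j)⁻¹ * ∑ j, W i j * Θstar j k := by
        simp only [hP', Finset.mul_sum, mul_assoc]
      have h2 : ∑ j, W i j * (Θstar i k - Θstar j k)
          = (∑ j, W i j) * Θstar i k - ∑ j, W i j * Θstar j k := by
        simp only [mul_sub, Finset.sum_sub_distrib, Finset.sum_mul]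
      rw [h1] at h
      rw [h2]
      have hdi := (hdeg i).ne'
      simp only [ha, hd] at h ⊢
      generalize (∑ j, W i j * Θstar j k) = S at h ⊢
      generalize (∑ j, W i j) = δ at h hdi ⊢
      field_simp at h ⊢
      linear_combination h
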